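/- arXiv:2206.11235 — 2 statements merged into one kernel-verified Lean document; each statement's English description precedes it below -/
import Mathlib

section
/- Suppose u : ℝ × ℝ → ℝ and its spatial derivatives ∂ₓu and ∂ₓ²u are continuous across x = 0, u is infinitely differentiable on each of {x ≤ 0} × ℝ and {x ≥ 0} × ℝ (with all one-sided limits of derivatives existing at x = 0), u satisfies on each open half-line the strong sixth-order equation N₂ ∂ₓ⁶u − N₁ ∂ₓ⁴u + N₀ ∂ₓ²u + D₃ ∂ₓ⁶∂ₜ²u − D₂ ∂ₓ⁴∂ₜ²u + D₁ ∂ₓ²∂ₜ²u − D₀ ∂ₜ²u = 0 (with the one-sided constant coefficients), and u satisfies for every t and every infinitely differentiable compactly supported v : ℝ → ℝ the weak form ∫_ℝ ( N₂ ∂ₓ³u ∂ₓ³v + N₁ ∂ₓ²u ∂ₓ²v + N₀ ∂ₓu ∂ₓv + D₃ ∂ₜ²∂ₓ³u ∂ₓ³v + D₂ ∂ₜ²∂ₓ²u ∂ₓ²v + D₁ ∂ₜ²∂ₓu ∂ₓv + D₀ ∂ₜ²u v ) dx = 0. Then for every t the following three higher-order continuity conditions hold at x = 0: ⟦N₂ ∂ₓ³u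 + D₃ ∂ₓ³∂ₜ²u⟧ = 0; ⟦−∂ₓ(N₂ ∂ₓ³u + D₃ ∂ₓ³∂ₜ²u) + N₁ ∂ₓ²u + D₂ ∂ₓ²∂ₜ²u⟧ = 0; and ⟦∂ₓ²(N₂ ∂ₓ³u + D₃ ∂ₓ³∂ₜ²u) − ∂ₓ(N₁ ∂ₓ²u + D₂ ∂ₓ²∂ₜ²u) + N₀ ∂ₓu + D₁ ∂ₓ∂ₜ²u⟧ = 0. -/
open MeasureTheory Filter

/-- Partial derivative in the first (space) variable. -/
noncomputable def pdx (u : ℝ → ℝ → ℝ) : ℝ → ℝ → ℝ := fun x t => deriv (fun y => u y t) x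

/-- Partial derivative in the second (time) variable. -/
noncomputable def pdt (u : ℝ → ℝ → ℝ) : ℝ → ℝ → ℝ := fun x t => deriv (fun s => u x s) t

/-- `f` is continuous away from `0` and has finite one-sided limits at `0`. -/
def PiecewiseCont (f : ℝ → ℝ) : Prop :=
  (∀ x, x ≠ 0 → ContinuousAt f x) ∧
    (∃ l, Tendsto f (nhdsWithin 0 (Set.Iio 0)) (nhds l)) ∧
    (∃ l, Tendsto f (nhdsWithin 0 (Set.Ioi 0)) (nhds l))

namespace PiecewiseCont

variable {f g : ℝ → ℝ}

theorem add (hf : PiecewiseCont f) (hg : PiecewiseCont g) :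
    PiecewiseCont (fun x => f x + g x) := by
  obtain ⟨hf, ⟨a, ha⟩, b, hb⟩ := hf
  obtain ⟨hg, ⟨c, hc⟩, d, hd⟩ := hg
  exact ⟨fun x hx => (hf x hx).add (hg x hx), ⟨_, ha.add hc⟩, ⟨_, hb.add hd⟩⟩

theorem mul (hf : PiecewiseCont f) (hg : PiecewiseCont g) :
    PiecewiseCont (fun x => f x * g x) := by
  obtain ⟨hf, ⟨a, ha⟩, b, hb⟩ := hf
  obtain ⟨hg, ⟨c, hc⟩, d, hd⟩ := hg
  exact ⟨fun x hx => (hf x hx).mul (hg x hx), ⟨_, ha.mul hc⟩, ⟨_, hb.mul hd⟩⟩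

theorem neg (hf : PiecewiseCont f) : PiecewiseCont (fun x => -f x) := by
  obtain ⟨hf, ⟨a, ha⟩, b, hb⟩ := hf
  exact ⟨fun x hx => (hf x hx).neg, ⟨_, ha.neg⟩, ⟨_, hb.neg⟩⟩

theorem sub (hf : PiecewiseCont f) (hg : PiecewiseCont g) :
    PiecewiseCont (fun x => f x - g x) := by
  simpa only [sub_eq_add_neg] using hf.add hg.neg

theorem of_continuous (hf : Continuous f) : PiecewiseCont f :=
  ⟨fun _ _ => hf.continuousAt, ⟨_, hf.continuousAt.mono_left nhdsWithin_le_nhds⟩,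
    ⟨_, hf.continuousAt.mono_left nhdsWithin_le_nhds⟩⟩

theorem intervalIntegrable_right (hf : PiecewiseCont f) {R : ℝ} (hR : 0 < R) :
    IntervalIntegrable f volume 0 R := by
  obtain ⟨hc, -, b, hb⟩ := hf
  have h := continuousOn_Icc_extendFrom_Ioo (f := f)
    (fun x hx => (hc x hx.1.ne').continuousWithinAt) hb
    ((hc R hR.ne').mono_left nhdsWithin_le_nhds)
  rw [intervalIntegrable_iff_integrableOn_Ioo_of_le hR.le]
  refine ((h.integrableOn_Icc (μ := volume)).mono_set Set.Ioo_subset_Icc_self).congr_fun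
    (fun x hx => ?_) measurableSet_Ioo
  exact extendFrom_eq (subset_closure hx) ((hc x hx.1.ne').mono_left nhdsWithin_le_nhds)

theorem intervalIntegrable_left (hf : PiecewiseCont f) {R : ℝ} (hR : 0 < R) :
    IntervalIntegrable f volume (-R) 0 := by
  obtain ⟨hc, ⟨b, hb⟩, -⟩ := hf
  have hR' : -R < 0 := neg_lt_zero.2 hR
  have h := continuousOn_Icc_extendFrom_Ioo (f := f)
    (fun x hx => (hc x hx.2.ne).continuousWithinAt)
    ((hc _ hR'.ne).mono_left nhdsWithin_le_nhds) hb
  rw [intervalIntegrable_iff_integrableOn_Ioo_of_le hR'.le]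
  refine ((h.integrableOn_Icc (μ := volume)).mono_set Set.Ioo_subset_Icc_self).congr_fun
    (fun x hx => ?_) measurableSet_Ioo
  exact extendFrom_eq (subset_closure hx) ((hc x hx.2.ne).mono_left nhdsWithin_le_nhds)

end PiecewiseCont

/-- Fundamental theorem of calculus for a compactly supported function with a jump at `0`. -/
theorem integral_deriv_eq_neg_jump {G g : ℝ → ℝ} {m p R : ℝ} (hR : 0 < R)
    (hG : ∀ x, x ≠ 0 → HasDerivAt G (g x) x) (hg : PiecewiseCont g)
    (hm : Tendsto G (nhdsWithin 0 (Set.Iio 0)) (nhds m))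
    (hp : Tendsto G (nhdsWithin 0 (Set.Ioi 0)) (nhds p))
    (hGR : ∀ x, R ≤ |x| → G x = 0) (hgR : ∀ x, R ≤ |x| → g x = 0) :
    ∫ x, g x = m - p := by
  have hsupp : Function.support g ⊆ Set.Ioc (-R) R := by
    intro x hx
    have h : |x| < R := not_le.1 fun h => hx (hgR x h)
    exact ⟨(abs_lt.1 h).1, (abs_lt.1 h).2.le⟩
  have hRR : -R < 0 := neg_lt_zero.2 hR
  have tR : Tendsto G (nhdsWithin R (Set.Iio R)) (nhds 0) := by
    have := (hG R hR.ne').continuousAt.tendsto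
    rw [hGR R (le_abs_self R)] at this
    exact this.mono_left nhdsWithin_le_nhds
  have tL : Tendsto G (nhdsWithin (-R) (Set.Ioi (-R))) (nhds 0) := by
    have := (hG (-R) hRR.ne).continuousAt.tendsto
    rw [hGR (-R) (abs_neg R ▸ le_abs_self R)] at this
    exact this.mono_left nhdsWithin_le_nhds
  rw [← intervalIntegral.integral_eq_integral_of_support_subset hsupp,
    ← intervalIntegral.integral_add_adjacent_intervals (hg.intervalIntegrable_left hR)
      (hg.intervalIntegrable_right hR),
    intervalIntegral.integral_eq_sub_of_hasDerivAt_of_tendsto hRR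
      (fun x hx => hG x hx.2.ne) (hg.intervalIntegrable_left hR) tL hm,
    intervalIntegral.integral_eq_sub_of_hasDerivAt_of_tendsto hR
      (fun x hx => hG x hx.1.ne') (hg.intervalIntegrable_right hR) hp tR]
  ring

/-- A test function with prescribed second-order Taylor data at `0`. -/
theorem exists_testFunction (c₀ c₁ c₂ : ℝ) :
    ∃ v : ℝ → ℝ, ContDiff ℝ (⊤ : ℕ∞) v ∧ HasCompactSupport v ∧
      v 0 = c₀ ∧ deriv v 0 = c₁ ∧ deriv (deriv v) 0 = c₂ := by
  let χ : ContDiffBump (0 : ℝ) := ⟨1, 2, one_pos, one_lt_two⟩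
  let P : ℝ → ℝ := fun x => c₀ + c₁ * x + c₂ / 2 * x ^ 2
  have hv : (fun x => P x * χ x) =ᶠ[nhds 0] P := by
    filter_upwards [χ.eventuallyEq_one] with x hx
    simp [hx]
  have hP : deriv P = fun x => c₁ + c₂ * x := by
    funext x
    have h := (((hasDerivAt_id' x).const_mul c₁).const_add c₀).fun_add
      ((hasDerivAt_pow 2 x).const_mul (c₂ / 2))
    refine h.deriv.trans ?_
    simp only [Nat.cast_ofNat]
    ring
  have hP' : deriv (deriv P) 0 = c₂ := by
    rw [hP]
    simp
  refine ⟨fun x => P x * χ x, ?_, χ.hasCompactSupport.mul_left, ?_, ?_, ?_⟩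
  · exact ContDiff.mul (by fun_prop) χ.contDiff
  · exact hv.eq_of_nhds.trans (by simp [P])
  · rw [hv.deriv_eq, hP]; simp
  · rw [hv.deriv.deriv_eq, hP']

/-- Vanishing of the integrated-by-parts third-order functional on all test functions forces the
boundary terms at `0` to be continuous. -/
theorem jumps_eq_of_weak {A₀ A₁ A₂ a₀ a₁ a₂ : ℝ → ℝ} {m₀ m₁ m₂ p₀ p₁ p₂ : ℝ}
    (hA₀ : ∀ x, x ≠ 0 → HasDerivAt A₀ (a₀ x) x) (hA₁ : ∀ x, x ≠ 0 → HasDerivAt A₁ (a₁ x) x)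
    (hA₂ : ∀ x, x ≠ 0 → HasDerivAt A₂ (a₂ x) x)
    (ha₀ : PiecewiseCont a₀) (ha₁ : PiecewiseCont a₁) (ha₂ : PiecewiseCont a₂)
    (hm₀ : Tendsto A₀ (nhdsWithin 0 (Set.Iio 0)) (nhds m₀))
    (hm₁ : Tendsto A₁ (nhdsWithin 0 (Set.Iio 0)) (nhds m₁))
    (hm₂ : Tendsto A₂ (nhdsWithin 0 (Set.Iio 0)) (nhds m₂))
    (hp₀ : Tendsto A₀ (nhdsWithin 0 (Set.Ioi 0)) (nhds p₀))
    (hp₁ : Tendsto A₁ (nhdsWithin 0 (Set.Ioi 0)) (nhds p₁))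
    (hp₂ : Tendsto A₂ (nhdsWithin 0 (Set.Ioi 0)) (nhds p₂))
    (hweak : ∀ v : ℝ → ℝ, ContDiff ℝ (⊤ : ℕ∞) v → HasCompactSupport v →
      ∫ x, (A₂ x * deriv^[3] v x + (a₂ x + A₁ x) * deriv^[2] v x
        + (a₁ x + A₀ x) * deriv v x + a₀ x * v x) = 0) :
    p₂ - m₂ = 0 ∧ p₁ - m₁ = 0 ∧ p₀ - m₀ = 0 := by
  obtain ⟨v, hv, hvc, h0, h1, h2⟩ := exists_testFunction (p₀ - m₀) (p₁ - m₁) (p₂ - m₂)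
  have hd : ∀ n, ContDiff ℝ (⊤ : ℕ∞) (deriv^[n] v) := fun n => hv.iterate_deriv n
  have hd1 : ∀ n x, HasDerivAt (deriv^[n] v) (deriv^[n + 1] v x) x := fun n x => by
    rw [Function.iterate_succ_apply']
    exact ((hd n).differentiable (by simp) x).hasDerivAt
  have hdc : ∀ n, HasCompactSupport (deriv^[n] v) := fun n => by
    induction n with
    | zero => exact hvc
    | succ n ih => rw [Function.iterate_succ_apply']; exact ih.deriv
  have hbd : ∀ n, ∃ R, ∀ x, R ≤ |x| → deriv^[n] v x = 0 := fun n => by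
    obtain ⟨R, -, hR⟩ := (hdc n).exists_pos_le_norm
    exact ⟨R, hR⟩
  choose R hR using hbd
  let S := max 1 (max (max (R 0) (R 1)) (max (R 2) (R 3)))
  have hz : ∀ x, S ≤ |x| → v x = 0 ∧ deriv v x = 0 ∧ deriv^[2] v x = 0 ∧ deriv^[3] v x = 0 := by
    intro x hx
    simp only [S, max_le_iff] at hx
    exact ⟨hR 0 x hx.2.1.1, hR 1 x hx.2.1.2, hR 2 x hx.2.2.1, hR 3 x hx.2.2.2⟩
  have pc : ∀ n, PiecewiseCont (deriv^[n] v) := fun n => .of_continuous (hd n).continuous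
  have pA : ∀ {A a : ℝ → ℝ} {m p : ℝ}, (∀ x, x ≠ 0 → HasDerivAt A (a x) x) →
      Tendsto A (nhdsWithin 0 (Set.Iio 0)) (nhds m) →
      Tendsto A (nhdsWithin 0 (Set.Ioi 0)) (nhds p) → PiecewiseCont A :=
    fun h hm hp => ⟨fun x hx => (h x hx).continuousAt, ⟨_, hm⟩, ⟨_, hp⟩⟩
  have tl : ∀ n (s : Set ℝ), Tendsto (deriv^[n] v) (nhdsWithin 0 s) (nhds (deriv^[n] v 0)) :=
    fun n s => (hd n).continuous.continuousAt.mono_left nhdsWithin_le_nhds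
  have key := integral_deriv_eq_neg_jump (R := S)
    (G := fun x => A₂ x * deriv^[2] v x + A₁ x * deriv^[1] v x + A₀ x * deriv^[0] v x)
    (g := fun x => A₂ x * deriv^[3] v x + (a₂ x + A₁ x) * deriv^[2] v x
        + (a₁ x + A₀ x) * deriv v x + a₀ x * v x)
    (lt_of_lt_of_le one_pos (le_max_left _ _))
    (fun x hx => by
      have h := (((hA₂ x hx).mul (hd1 2 x)).add ((hA₁ x hx).mul (hd1 1 x))).add
        ((hA₀ x hx).mul (hd1 0 x))
      refine h.congr_deriv ?_
      simp only [Function.iterate_succ, Function.iterate_zero, Function.comp, id]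
      ring)
    (((((pA hA₂ hm₂ hp₂).mul (pc 3)).add ((ha₂.add (pA hA₁ hm₁ hp₁)).mul (pc 2))).add
      ((ha₁.add (pA hA₀ hm₀ hp₀)).mul (pc 1))).add (ha₀.mul (pc 0)))
    (((hm₂.mul (tl 2 _)).add (hm₁.mul (tl 1 _))).add (hm₀.mul (tl 0 _)))
    (((hp₂.mul (tl 2 _)).add (hp₁.mul (tl 1 _))).add (hp₀.mul (tl 0 _)))
    (fun x hx => by
      obtain ⟨e0, e1, e2, -⟩ := hz x hx
      simp only [Function.iterate_one, Function.iterate_zero, id, e0, e1, e2]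
      ring)
    (fun x hx => by
      obtain ⟨e0, e1, e2, e3⟩ := hz x hx
      simp only [e0, e1, e2, e3]
      ring)
  rw [hweak v hv hvc] at key
  simp only [Function.iterate_succ, Function.iterate_zero, Function.comp, id, h0, h1, h2] at key
  have hsq : (p₂ - m₂) ^ 2 + (p₁ - m₁) ^ 2 + (p₀ - m₀) ^ 2 = 0 := by linarith
  refine ⟨?_, ?_, ?_⟩ <;>
    exact pow_eq_zero_iff two_ne_zero |>.1
      (by nlinarith [sq_nonneg (p₂ - m₂), sq_nonneg (p₁ - m₁), sq_nonneg (p₀ - m₀)])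

/-- Smoothness of `w` off the interface `x = 0`. -/
def SmoothOff (w : ℝ → ℝ → ℝ) : Prop :=
  ∀ x t, x ≠ 0 → ContDiffAt ℝ (⊤ : ℕ∞) (Function.uncurry w) (x, t)

theorem eventually_fst_ne_zero {x : ℝ} (t : ℝ) (hx : x ≠ 0) :
    ∀ᶠ p : ℝ × ℝ in nhds (x, t), p.1 ≠ 0 :=
  continuous_fst.continuousAt.eventually_ne hx

namespace SmoothOff

variable {w : ℝ → ℝ → ℝ}

theorem hasFDerivAt (hw : SmoothOff w) {x : ℝ} (t : ℝ) (hx : x ≠ 0) :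
    HasFDerivAt (Function.uncurry w) (fderiv ℝ (Function.uncurry w) (x, t)) (x, t) :=
  ((hw x t hx).differentiableAt (by simp)).hasFDerivAt

theorem hasDerivAt_fderiv_fst (hw : SmoothOff w) {x : ℝ} (t : ℝ) (hx : x ≠ 0) :
    HasDerivAt (fun y => w y t) (fderiv ℝ (Function.uncurry w) (x, t) (1, 0)) x :=
  (hw.hasFDerivAt t hx).comp_hasDerivAt (f := fun y => (y, t)) x
    ((hasDerivAt_id' x).prodMk (hasDerivAt_const x t))

theorem hasDerivAt_fderiv_snd (hw : SmoothOff w) {x : ℝ} (t : ℝ) (hx : x ≠ 0) :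
    HasDerivAt (fun s => w x s) (fderiv ℝ (Function.uncurry w) (x, t) (0, 1)) t :=
  (hw.hasFDerivAt t hx).comp_hasDerivAt t ((hasDerivAt_const t x).prodMk (hasDerivAt_id' t))

theorem hasDerivAt_pdx (hw : SmoothOff w) {x : ℝ} (t : ℝ) (hx : x ≠ 0) :
    HasDerivAt (fun y => w y t) (pdx w x t) x :=
  (hw.hasDerivAt_fderiv_fst t hx).differentiableAt.hasDerivAt

theorem pdx_eq (hw : SmoothOff w) {x : ℝ} (t : ℝ) (hx : x ≠ 0) :
    Function.uncurry (pdx w) =ᶠ[nhds (x, t)]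
      fun p => fderiv ℝ (Function.uncurry w) p (1, 0) := by
  filter_upwards [eventually_fst_ne_zero t hx] with p hp
  exact (hw.hasDerivAt_fderiv_fst p.2 hp).deriv

theorem pdt_eq (hw : SmoothOff w) {x : ℝ} (t : ℝ) (hx : x ≠ 0) :
    Function.uncurry (pdt w) =ᶠ[nhds (x, t)]
      fun p => fderiv ℝ (Function.uncurry w) p (0, 1) := by
  filter_upwards [eventually_fst_ne_zero t hx] with p hp
  exact (hw.hasDerivAt_fderiv_snd p.2 hp).deriv

theorem fderiv (hw : SmoothOff w) {x : ℝ} (t : ℝ) (hx : x ≠ 0) :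
    ContDiffAt ℝ (⊤ : ℕ∞) (fderiv ℝ (Function.uncurry w)) (x, t) :=
  (hw x t hx).fderiv_right (by simp)

theorem pdx (hw : SmoothOff w) : SmoothOff (pdx w) := fun _ t hx =>
  ((hw.fderiv t hx).clm_apply contDiffAt_const).congr_of_eventuallyEq (hw.pdx_eq t hx)

theorem pdt (hw : SmoothOff w) : SmoothOff (pdt w) := fun _ t hx =>
  ((hw.fderiv t hx).clm_apply contDiffAt_const).congr_of_eventuallyEq (hw.pdt_eq t hx)

theorem iterate_pdx (hw : SmoothOff w) (n : ℕ) : SmoothOff (_root_.pdx^[n] w) := by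
  induction n with
  | zero => exact hw
  | succ n ih => rw [Function.iterate_succ_apply']; exact ih.pdx

theorem pdt_pdx (hw : SmoothOff w) {x : ℝ} (t : ℝ) (hx : x ≠ 0) :
    _root_.pdt (_root_.pdx w) x t = _root_.pdx (_root_.pdt w) x t := by
  have hd : HasFDerivAt (_root_.fderiv ℝ (Function.uncurry w))
      (_root_.fderiv ℝ (_root_.fderiv ℝ (Function.uncurry w)) (x, t)) (x, t) :=
    ((hw.fderiv t hx).differentiableAt (by simp)).hasFDerivAt
  have hsymm : IsSymmSndFDerivAt ℝ (Function.uncurry w) (x, t) :=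
    (hw x t hx).isSymmSndFDerivAt (by
      rw [minSmoothness_of_isRCLikeNormedField]
      exact WithTop.coe_le_coe.2 le_top)
  have e1 : _root_.pdt (_root_.pdx w) x t
      = _root_.fderiv ℝ (Function.uncurry (_root_.pdx w)) (x, t) (0, 1) :=
    (hw.pdx.hasDerivAt_fderiv_snd t hx).deriv
  have e2 : _root_.pdx (_root_.pdt w) x t
      = _root_.fderiv ℝ (Function.uncurry (_root_.pdt w)) (x, t) (1, 0) :=
    (hw.pdt.hasDerivAt_fderiv_fst t hx).deriv
  rw [e1, e2, (hw.pdx_eq t hx).fderiv_eq, (hw.pdt_eq t hx).fderiv_eq,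
    (hd.clm_apply (hasFDerivAt_const _ _)).fderiv, (hd.clm_apply (hasFDerivAt_const _ _)).fderiv]
  simpa using hsymm (0, 1) (1, 0)

end SmoothOff

theorem pdx_congr {w w' : ℝ → ℝ → ℝ} (h : ∀ x t, x ≠ 0 → w x t = w' x t) (x t : ℝ)
    (hx : x ≠ 0) : pdx w x t = pdx w' x t := by
  refine Filter.EventuallyEq.deriv_eq ?_
  filter_upwards [eventually_ne_nhds hx] with y hy using h y t hy

theorem pdt_congr {w w' : ℝ → ℝ → ℝ} (h : ∀ x t, x ≠ 0 → w x t = w' x t) (x t : ℝ)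
    (hx : x ≠ 0) : pdt w x t = pdt w' x t := by
  simp only [pdt, h x _ hx]

theorem SmoothOff.pdt_iterate_pdx {w : ℝ → ℝ → ℝ} (hw : SmoothOff w) (n : ℕ) :
    ∀ x t, x ≠ 0 → _root_.pdt (_root_.pdx^[n] w) x t = _root_.pdx^[n] (_root_.pdt w) x t := by
  induction n with
  | zero => intro x t _; rfl
  | succ n ih =>
    intro x t hx
    rw [Function.iterate_succ_apply', Function.iterate_succ_apply',
      (hw.iterate_pdx n).pdt_pdx t hx]
    exact pdx_congr ih x t hx

theorem SmoothOff.pdt_pdt_iterate_pdx {w : ℝ → ℝ → ℝ} (hw : SmoothOff w) (n : ℕ)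
    (x t : ℝ) (hx : x ≠ 0) :
    _root_.pdt^[2] (_root_.pdx^[n] w) x t = _root_.pdx^[n] (_root_.pdt^[2] w) x t :=
  (pdt_congr (hw.pdt_iterate_pdx n) x t hx).trans (hw.pdt.pdt_iterate_pdx n x t hx)

theorem smoothOff_of_halfPlanes {u : ℝ → ℝ → ℝ}
    (hsm : ContDiffOn ℝ (⊤ : ℕ∞) (Function.uncurry u) {p : ℝ × ℝ | p.1 ≤ 0})
    (hsp : ContDiffOn ℝ (⊤ : ℕ∞) (Function.uncurry u) {p : ℝ × ℝ | 0 ≤ p.1}) :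
    SmoothOff u := by
  intro x t hx
  rcases lt_or_gt_of_ne hx with h | h
  · refine hsm.contDiffAt ?_
    filter_upwards [continuous_fst.continuousAt.eventually_lt_const
      (show (x, t).1 < 0 from h)] with p hp using hp.le
  · refine hsp.contDiffAt ?_
    filter_upwards [continuous_fst.continuousAt.eventually_const_lt
      (show 0 < (x, t).1 from h)] with p hp using hp.le

/-- A function constant on each open half-line is locally constant off `0`. -/
theorem eventuallyEq_const_of_piecewise {c : ℝ → ℝ} {cm cp : ℝ} (hm : ∀ x < (0 : ℝ), c x = cm)
    (hp : ∀ x > (0 : ℝ), c x = cp) (x : ℝ) (hx : x ≠ 0) : c =ᶠ[nhds x] fun _ => c x := by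
  rcases lt_or_gt_of_ne hx with h | h
  · filter_upwards [eventually_lt_nhds h] with y hy
    rw [hm y hy, hm x h]
  · filter_upwards [eventually_gt_nhds h] with y hy
    rw [hp y hy, hp x h]

theorem piecewiseCont_of_piecewise {c : ℝ → ℝ} {cm cp : ℝ} (hm : ∀ x < (0 : ℝ), c x = cm)
    (hp : ∀ x > (0 : ℝ), c x = cp) : PiecewiseCont c := by
  refine ⟨fun x hx => ?_, ⟨cm, ?_⟩, ⟨cp, ?_⟩⟩
  · exact continuousAt_const.congr (eventuallyEq_const_of_piecewise hm hp x hx).symm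
  · exact tendsto_const_nhds.congr' (eventually_nhdsWithin_of_forall fun x hx => (hm x hx).symm)
  · exact tendsto_const_nhds.congr' (eventually_nhdsWithin_of_forall fun x hx => (hp x hx).symm)

theorem HasDerivAt.mul_of_eventuallyEq_const {c f : ℝ → ℝ} {f' x : ℝ} (hf : HasDerivAt f f' x)
    (hc : c =ᶠ[nhds x] fun _ => c x) : HasDerivAt (fun y => c y * f y) (c x * f') x := by
  refine (hf.const_mul (c x)).congr_of_eventuallyEq ?_
  filter_upwards [hc] with y hy
  rw [hy]

/-- The three higher-order continuity conditions at `x = 0` for the sixth-order homogenized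
model with piecewise constant coefficients. -/
theorem stmt_15 (N0 N1 N2 D0 D1 D2 D3 : ℝ → ℝ)
    (N0m N0p N1m N1p N2m N2p D0m D0p D1m D1p D2m D2p D3m D3p : ℝ)
    (hN0m : ∀ x < (0:ℝ), N0 x = N0m) (hN0p : ∀ x > (0:ℝ), N0 x = N0p)
    (hN1m : ∀ x < (0:ℝ), N1 x = N1m) (hN1p : ∀ x > (0:ℝ), N1 x = N1p)
    (hN2m : ∀ x < (0:ℝ), N2 x = N2m) (hN2p : ∀ x > (0:ℝ), N2 x = N2p)
    (hD0m : ∀ x < (0:ℝ), D0 x = D0m) (hD0p : ∀ x > (0:ℝ), D0 x = D0p)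
    (hD1m : ∀ x < (0:ℝ), D1 x = D1m) (hD1p : ∀ x > (0:ℝ), D1 x = D1p)
    (hD2m : ∀ x < (0:ℝ), D2 x = D2m) (hD2p : ∀ x > (0:ℝ), D2 x = D2p)
    (hD3m : ∀ x < (0:ℝ), D3 x = D3m) (hD3p : ∀ x > (0:ℝ), D3 x = D3p)
    (u : ℝ → ℝ → ℝ)
    (hcont : Continuous (Function.uncurry u))
    (hcontdx : ∀ t L₁ L₂ : ℝ,
      Tendsto (fun x => pdx u x t) (nhdsWithin 0 (Set.Iio 0)) (nhds L₁) →
      Tendsto (fun x => pdx u x t) (nhdsWithin 0 (Set.Ioi 0)) (nhds L₂) → L₁ = L₂)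
    (hcontdxx : ∀ t L₁ L₂ : ℝ,
      Tendsto (fun x => pdx^[2] u x t) (nhdsWithin 0 (Set.Iio 0)) (nhds L₁) →
      Tendsto (fun x => pdx^[2] u x t) (nhdsWithin 0 (Set.Ioi 0)) (nhds L₂) → L₁ = L₂)
    (hsm : ContDiffOn ℝ (⊤ : ℕ∞) (Function.uncurry u) {p : ℝ × ℝ | p.1 ≤ 0})
    (hsp : ContDiffOn ℝ (⊤ : ℕ∞) (Function.uncurry u) {p : ℝ × ℝ | 0 ≤ p.1})
    (hlim : ∀ (n m : ℕ) (t : ℝ),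
      (∃ L : ℝ, Tendsto (fun x => pdx^[n] (pdt^[m] u) x t) (nhdsWithin 0 (Set.Iio 0)) (nhds L)) ∧
      (∃ L : ℝ, Tendsto (fun x => pdx^[n] (pdt^[m] u) x t) (nhdsWithin 0 (Set.Ioi 0)) (nhds L)))
    (hstrong : ∀ x t : ℝ, x ≠ 0 →
      N2 x * pdx^[6] u x t - N1 x * pdx^[4] u x t + N0 x * pdx^[2] u x t
        + D3 x * pdx^[6] (pdt^[2] u) x t - D2 x * pdx^[4] (pdt^[2] u) x t
        + D1 x * pdx^[2] (pdt^[2] u) x t - D0 x * pdt^[2] u x t = 0)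
    (hweak : ∀ (t : ℝ) (v : ℝ → ℝ), ContDiff ℝ (⊤ : ℕ∞) v → HasCompactSupport v →
      (∫ x : ℝ,
        (N2 x * pdx^[3] u x t * deriv^[3] v x
          + N1 x * pdx^[2] u x t * deriv^[2] v x
          + N0 x * pdx u x t * deriv v x
          + D3 x * pdt^[2] (pdx^[3] u) x t * deriv^[3] v x
          + D2 x * pdt^[2] (pdx^[2] u) x t * deriv^[2] v x
          + D1 x * pdt^[2] (pdx u) x t * deriv v x
          + D0 x * pdt^[2] u x t * v x)) = 0) :
    ∀ t : ℝ,
      (∀ L₁ L₂ : ℝ,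
        Tendsto (fun x => N2 x * pdx^[3] u x t + D3 x * pdx^[3] (pdt^[2] u) x t)
          (nhdsWithin 0 (Set.Iio 0)) (nhds L₁) →
        Tendsto (fun x => N2 x * pdx^[3] u x t + D3 x * pdx^[3] (pdt^[2] u) x t)
          (nhdsWithin 0 (Set.Ioi 0)) (nhds L₂) →
        L₂ - L₁ = 0)
      ∧ (∀ L₁ L₂ : ℝ,
        Tendsto (fun x =>
            - pdx (fun y s => N2 y * pdx^[3] u y s + D3 y * pdx^[3] (pdt^[2] u) y s) x t
              + N1 x * pdx^[2] u x t + D2 x * pdx^[2] (pdt^[2] u) x t)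
          (nhdsWithin 0 (Set.Iio 0)) (nhds L₁) →
        Tendsto (fun x =>
            - pdx (fun y s => N2 y * pdx^[3] u y s + D3 y * pdx^[3] (pdt^[2] u) y s) x t
              + N1 x * pdx^[2] u x t + D2 x * pdx^[2] (pdt^[2] u) x t)
          (nhdsWithin 0 (Set.Ioi 0)) (nhds L₂) →
        L₂ - L₁ = 0)
      ∧ (∀ L₁ L₂ : ℝ,
        Tendsto (fun x =>
            pdx^[2] (fun y s => N2 y * pdx^[3] u y s + D3 y * pdx^[3] (pdt^[2] u) y s) x t
              - pdx (fun y s => N1 y * pdx^[2] u y s + D2 y * pdx^[2] (pdt^[2] u) y s) x t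
              + N0 x * pdx u x t + D1 x * pdx (pdt^[2] u) x t)
          (nhdsWithin 0 (Set.Iio 0)) (nhds L₁) →
        Tendsto (fun x =>
            pdx^[2] (fun y s => N2 y * pdx^[3] u y s + D3 y * pdx^[3] (pdt^[2] u) y s) x t
              - pdx (fun y s => N1 y * pdx^[2] u y s + D2 y * pdx^[2] (pdt^[2] u) y s) x t
              + N0 x * pdx u x t + D1 x * pdx (pdt^[2] u) x t)
          (nhdsWithin 0 (Set.Ioi 0)) (nhds L₂) →
        L₂ - L₁ = 0) := by
  intro t
  have hu : SmoothOff u := smoothOff_of_halfPlanes hsm hsp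
  have hw : SmoothOff (pdt^[2] u) := hu.pdt.pdt
  have df : ∀ n x, x ≠ 0 → HasDerivAt (fun y => pdx^[n] u y t) (pdx^[n + 1] u x t) x :=
    fun n x hx => by
      rw [Function.iterate_succ_apply' pdx]; exact (hu.iterate_pdx n).hasDerivAt_pdx t hx
  have dg : ∀ n x, x ≠ 0 →
      HasDerivAt (fun y => pdx^[n] (pdt^[2] u) y t) (pdx^[n + 1] (pdt^[2] u) x t) x :=
    fun n x hx => by
      rw [Function.iterate_succ_apply' pdx]; exact (hw.iterate_pdx n).hasDerivAt_pdx t hx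
  have cf : ∀ n, PiecewiseCont (fun x => pdx^[n] u x t) := fun n =>
    ⟨fun x hx => (df n x hx).continuousAt, hlim n 0 t⟩
  have cg : ∀ n, PiecewiseCont (fun x => pdx^[n] (pdt^[2] u) x t) := fun n =>
    ⟨fun x hx => (dg n x hx).continuousAt, hlim n 2 t⟩
  -- a flux `N ∂ₓⁿu + D ∂ₓⁿ∂ₜ²u` and its space derivative
  have flux : ∀ {N D : ℝ → ℝ} {Nm Np Dm Dp : ℝ}, (∀ x < (0 : ℝ), N x = Nm) →
      (∀ x > (0 : ℝ), N x = Np) → (∀ x < (0 : ℝ), D x = Dm) → (∀ x > (0 : ℝ), D x = Dp) →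
      (∀ n, PiecewiseCont (fun x => N x * pdx^[n] u x t + D x * pdx^[n] (pdt^[2] u) x t)) ∧
      ∀ n x, x ≠ 0 → HasDerivAt (fun y => N y * pdx^[n] u y t + D y * pdx^[n] (pdt^[2] u) y t)
        (N x * pdx^[n + 1] u x t + D x * pdx^[n + 1] (pdt^[2] u) x t) x := by
    intro N D Nm Np Dm Dp h1 h2 h3 h4
    exact ⟨fun n => ((piecewiseCont_of_piecewise h1 h2).mul (cf n)).add
        ((piecewiseCont_of_piecewise h3 h4).mul (cg n)),
      fun n x hx => ((df n x hx).mul_of_eventuallyEq_const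
        (eventuallyEq_const_of_piecewise h1 h2 x hx)).add ((dg n x hx).mul_of_eventuallyEq_const
        (eventuallyEq_const_of_piecewise h3 h4 x hx))⟩
  obtain ⟨c3, d3⟩ := flux hN2m hN2p hD3m hD3p
  obtain ⟨c2, d2⟩ := flux hN1m hN1p hD2m hD2p
  obtain ⟨c1, d1⟩ := flux hN0m hN0p hD1m hD1p
  have e3 : ∀ x, x ≠ 0 →
      pdx (fun y s => N2 y * pdx^[3] u y s + D3 y * pdx^[3] (pdt^[2] u) y s) x t
        = N2 x * pdx^[4] u x t + D3 x * pdx^[4] (pdt^[2] u) x t :=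
    fun x hx => (d3 3 x hx).deriv
  have e2 : ∀ x, x ≠ 0 →
      pdx (fun y s => N1 y * pdx^[2] u y s + D2 y * pdx^[2] (pdt^[2] u) y s) x t
        = N1 x * pdx^[3] u x t + D2 x * pdx^[3] (pdt^[2] u) x t :=
    fun x hx => (d2 2 x hx).deriv
  have e3' : ∀ x, x ≠ 0 →
      pdx^[2] (fun y s => N2 y * pdx^[3] u y s + D3 y * pdx^[3] (pdt^[2] u) y s) x t
        = N2 x * pdx^[5] u x t + D3 x * pdx^[5] (pdt^[2] u) x t := by
    intro x hx
    refine HasDerivAt.deriv ((d3 4 x hx).congr_of_eventuallyEq ?_)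
    filter_upwards [eventually_ne_nhds hx] with y hy using e3 y hy
  let A₂ : ℝ → ℝ := fun x => N2 x * pdx^[3] u x t + D3 x * pdx^[3] (pdt^[2] u) x t
  let A₁ : ℝ → ℝ := fun x => -(N2 x * pdx^[4] u x t + D3 x * pdx^[4] (pdt^[2] u) x t)
    + (N1 x * pdx^[2] u x t + D2 x * pdx^[2] (pdt^[2] u) x t)
  let A₀ : ℝ → ℝ := fun x => (N2 x * pdx^[5] u x t + D3 x * pdx^[5] (pdt^[2] u) x t)
    - (N1 x * pdx^[3] u x t + D2 x * pdx^[3] (pdt^[2] u) x t)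
    + (N0 x * pdx^[1] u x t + D1 x * pdx^[1] (pdt^[2] u) x t)
  have cA₂ : PiecewiseCont A₂ := c3 3
  have cA₁ : PiecewiseCont A₁ := (c3 4).neg.add (c2 2)
  have cA₀ : PiecewiseCont A₀ := ((c3 5).sub (c2 3)).add (c1 1)
  obtain ⟨-, ⟨m₂, hm₂⟩, p₂, hp₂⟩ := cA₂
  obtain ⟨-, ⟨m₁, hm₁⟩, p₁, hp₁⟩ := cA₁
  obtain ⟨-, ⟨m₀, hm₀⟩, p₀, hp₀⟩ := cA₀
  obtain ⟨j₂, j₁, j₀⟩ := jumps_eq_of_weak (A₀ := A₀) (A₁ := A₁) (A₂ := A₂)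
    (fun x hx => ((d3 5 x hx).sub (d2 3 x hx)).add (d1 1 x hx))
    (fun x hx => (d3 4 x hx).neg.add (d2 2 x hx)) (fun x hx => d3 3 x hx)
    (((c3 6).sub (c2 4)).add (c1 2)) ((c3 5).neg.add (c2 3)) (c3 4)
    hm₀ hm₁ hm₂ hp₀ hp₁ hp₂ (fun v hv hvc => by
      rw [← hweak t v hv hvc]
      refine integral_congr_ae ?_
      filter_upwards [compl_mem_ae_iff.2 (measure_singleton (0 : ℝ))] with x hx
      have hx : x ≠ 0 := hx
      have s1 : pdt^[2] (pdx u) x t = pdx^[1] (pdt^[2] u) x t := hu.pdt_pdt_iterate_pdx 1 x t hx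
      rw [hu.pdt_pdt_iterate_pdx 3 x t hx, hu.pdt_pdt_iterate_pdx 2 x t hx, s1]
      have hs := hstrong x t hx
      simp only [A₂, A₁, A₀, Nat.reduceAdd]
      rw [Function.iterate_one pdx] at *
      linear_combination v x * hs)
  have fin : ∀ {A B : ℝ → ℝ} {m p : ℝ}, (∀ x, x ≠ 0 → B x = A x) → p - m = 0 →
      Tendsto A (nhdsWithin 0 (Set.Iio 0)) (nhds m) →
      Tendsto A (nhdsWithin 0 (Set.Ioi 0)) (nhds p) → ∀ L₁ L₂ : ℝ,
      Tendsto B (nhdsWithin 0 (Set.Iio 0)) (nhds L₁) →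
      Tendsto B (nhdsWithin 0 (Set.Ioi 0)) (nhds L₂) → L₂ - L₁ = 0 := by
    intro A B m p hAB hj hm hp L₁ L₂ h1 h2
    have e1 : B =ᶠ[nhdsWithin 0 (Set.Iio 0)] A :=
      eventually_nhdsWithin_of_forall fun x hx => hAB x (ne_of_lt hx)
    have e2 : B =ᶠ[nhdsWithin 0 (Set.Ioi 0)] A :=
      eventually_nhdsWithin_of_forall fun x hx => hAB x (ne_of_gt hx)
    rw [tendsto_nhds_unique (h1.congr' e1) hm, tendsto_nhds_unique (h2.congr' e2) hp, hj]
  refine ⟨fin (fun x _ => rfl) j₂ hm₂ hp₂, fin (fun x hx => ?_) j₁ hm₁ hp₁,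
    fin (fun x hx => ?_) j₀ hm₀ hp₀⟩
  · rw [e3 x hx]; simp only [A₁]; ring
  · rw [e3' x hx, e2 x hx]; simp only [A₀, Function.iterate_one]; ring
end

section
/- Suppose u : ℝ × ℝ → ℝ and its spatial derivative ∂ₓu are continuous across x = 0, u is infinitely differentiable on each of {x ≤ 0} × ℝ and {x ≥ 0} × ℝ (with all one-sided limits of derivatives existing at x = 0), u satisfies on each open half-line the strong two-band equation ∂ₜ⁴u − A₁ ∂ₜ⁴∂ₓ²u + A₂ ∂ₜ⁴∂ₓ⁴u − A₃ ∂ₜ²∂ₓ⁴u + A₄ ∂ₜ²∂ₓ²u + A₅ ∂ₜ²u − A₆ ∂ₓ²u + A₇ ∂ₓ⁴u = 0 (with the one-sided constant coefficients), and u satisfies for every infinitely differentiable v : ℝ × ℝ → ℝ of compact support in space-time the weak form ∫∫ ( ∂ₜ²u ∂ₜ²v + A₁(x) ∂ₜ²∂ₓu ∂ₜ²∂ₓv + A₂(x) ∂ₜ²∂ₓ²u ∂ₜ²∂ₓ²v + A₃(x) ∂ₜ∂ₓ²u ∂ₜ∂ₓ²v + A₄(x) ∂ₜ∂ₓu ∂ₜ∂ₓv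 − A₅(x) ∂ₜu ∂ₜv + A₆(x) ∂ₓu ∂ₓv + A₇(x) ∂ₓ²u ∂ₓ²v ) dx dt = 0. Then for every t the higher-order continuity condition ⟦A₂ ∂ₜ⁴∂ₓ²u − A₃ ∂ₜ²∂ₓ²u + A₇ ∂ₓ²u⟧ = 0 holds at x = 0. -/
open MeasureTheory Filter

/-- The derivative of `f` along `v`, taken within `S`. -/
noncomputable def dirDerivWithin (S : Set (ℝ × ℝ)) (v : ℝ × ℝ) (f : ℝ × ℝ → ℝ) : ℝ × ℝ → ℝ :=
  fun p => fderivWithin ℝ f S p v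

theorem ContDiffOn.dirDerivWithin {S : Set (ℝ × ℝ)} (hS : UniqueDiffOn ℝ S) (v : ℝ × ℝ)
    {f : ℝ × ℝ → ℝ} (hf : ContDiffOn ℝ (⊤ : ℕ∞) f S) :
    ContDiffOn ℝ (⊤ : ℕ∞) (dirDerivWithin S v f) S :=
  (hf.fderivWithin hS (by simp)).clm_apply contDiffOn_const

theorem ContDiffOn.iterate_dirDerivWithin {S : Set (ℝ × ℝ)} (hS : UniqueDiffOn ℝ S) (v : ℝ × ℝ)
    {f : ℝ × ℝ → ℝ} (hf : ContDiffOn ℝ (⊤ : ℕ∞) f S) (n : ℕ) :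
    ContDiffOn ℝ (⊤ : ℕ∞) ((_root_.dirDerivWithin S v)^[n] f) S := by
  induction n with
  | zero => exact hf
  | succ n ih =>
    rw [Function.iterate_succ_apply']
    exact ih.dirDerivWithin hS v

theorem pdx_eq_dirDerivWithin {S : Set (ℝ × ℝ)} {f : ℝ → ℝ → ℝ} {F : ℝ × ℝ → ℝ}
    (hF : ContDiffOn ℝ (⊤ : ℕ∞) F S) (h : ∀ x t, (x, t) ∈ interior S → f x t = F (x, t))
    (x t : ℝ) (hx : (x, t) ∈ interior S) :
    pdx f x t = dirDerivWithin S (1, 0) F (x, t) := by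
  have hd : HasFDerivWithinAt F (fderivWithin ℝ F S (x, t)) S (x, t) :=
    ((hF.differentiableOn (by simp)) _ (interior_subset hx)).hasFDerivWithinAt
  have hc : HasDerivAt (fun y : ℝ => (y, t)) (1, 0) x :=
    (hasDerivAt_id x).prodMk (hasDerivAt_const x t)
  have he : ∀ᶠ y in nhds x, (y, t) ∈ interior S :=
    hc.continuousAt.eventually (isOpen_interior.mem_nhds hx)
  have key := hd.comp_hasDerivAt x hc (he.mono fun y hy => interior_subset hy)
  exact (key.congr_of_eventuallyEq (he.mono fun y hy => h y t hy)).deriv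

theorem pdt_eq_dirDerivWithin {S : Set (ℝ × ℝ)} {f : ℝ → ℝ → ℝ} {F : ℝ × ℝ → ℝ}
    (hF : ContDiffOn ℝ (⊤ : ℕ∞) F S) (h : ∀ x t, (x, t) ∈ interior S → f x t = F (x, t))
    (x t : ℝ) (hx : (x, t) ∈ interior S) :
    pdt f x t = dirDerivWithin S (0, 1) F (x, t) := by
  have hd : HasFDerivWithinAt F (fderivWithin ℝ F S (x, t)) S (x, t) :=
    ((hF.differentiableOn (by simp)) _ (interior_subset hx)).hasFDerivWithinAt
  have hc : HasDerivAt (fun s : ℝ => (x, s)) (0, 1) t :=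
    (hasDerivAt_const t x).prodMk (hasDerivAt_id t)
  have he : ∀ᶠ s in nhds t, (x, s) ∈ interior S :=
    hc.continuousAt.eventually (isOpen_interior.mem_nhds hx)
  have key := hd.comp_hasDerivAt t hc (he.mono fun y hy => interior_subset hy)
  exact (key.congr_of_eventuallyEq (he.mono fun s hs => h x s hs)).deriv

/-- The mixed partial derivatives of a function smooth on the closed strip `I ×ˢ univ` extend
continuously to the plane, through a retraction `r` of the line onto `I`. -/
theorem exists_continuous_extension_partials {I : Set ℝ} (hI : Convex ℝ I)
    (hne : (interior I).Nonempty) {r : ℝ → ℝ} (hr : Continuous r) (hrI : ∀ x, r x ∈ I)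
    (hrid : ∀ x ∈ interior I, r x = x) {u : ℝ → ℝ → ℝ}
    (hu : ContDiffOn ℝ (⊤ : ℕ∞) (Function.uncurry u) (I ×ˢ Set.univ)) :
    ∃ Q : ℕ → ℕ → ℝ × ℝ → ℝ, (∀ n m, Continuous (Q n m)) ∧
      (∀ n m x t, x ∈ interior I → pdt^[m] (pdx^[n] u) x t = Q n m (x, t)) ∧
      (∀ n m x t, HasDerivAt (fun s => Q n m (x, s)) (Q n (m + 1) (x, t)) t) := by
  set S : Set (ℝ × ℝ) := I ×ˢ Set.univ with hSdef
  have hint : interior S = interior I ×ˢ Set.univ := by rw [hSdef, interior_prod_eq, interior_univ]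
  have hS : UniqueDiffOn ℝ S := (uniqueDiffOn_convex hI hne).prod uniqueDiffOn_univ
  set F : ℕ → ℕ → ℝ × ℝ → ℝ := fun n m =>
    (dirDerivWithin S (0, 1))^[m] ((dirDerivWithin S (1, 0))^[n] (Function.uncurry u)) with hFdef
  have hFx (n : ℕ) : ContDiffOn ℝ (⊤ : ℕ∞) ((dirDerivWithin S (1, 0))^[n] (Function.uncurry u)) S :=
    hu.iterate_dirDerivWithin hS _ n
  have hF (n m : ℕ) : ContDiffOn ℝ (⊤ : ℕ∞) (F n m) S := (hFx n).iterate_dirDerivWithin hS _ m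
  have hmem (x t : ℝ) : (r x, t) ∈ S := ⟨hrI x, trivial⟩
  refine ⟨fun n m p => F n m (r p.1, p.2), fun n m => ?_, fun n m x t hx => ?_, fun n m x t => ?_⟩
  · exact (hF n m).continuousOn.comp_continuous (by fun_prop) fun p => hmem _ _
  · have hn : ∀ x t, (x, t) ∈ interior S → pdx^[n] u x t = F n 0 (x, t) := by
      induction n with
      | zero => intro x t _; rfl
      | succ n ih =>
        intro x t hxt
        simp only [hFdef, Function.iterate_succ_apply', Function.iterate_zero, id] at ih ⊢
        exact pdx_eq_dirDerivWithin (hFx n) ih x t hxt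
    have hm : ∀ x t, (x, t) ∈ interior S → pdt^[m] (pdx^[n] u) x t = F n m (x, t) := by
      induction m with
      | zero => exact hn
      | succ m ih =>
        intro x t hxt
        simp only [hFdef, Function.iterate_succ_apply'] at ih ⊢
        exact pdt_eq_dirDerivWithin (hF n m) ih x t hxt
    simp only [hrid x hx]
    exact hm x t (by rw [hint]; exact ⟨hx, trivial⟩)
  · have hd : HasFDerivWithinAt (F n m) (fderivWithin ℝ (F n m) S (r x, t)) S (r x, t) :=
      (((hF n m).differentiableOn (by simp)) _ (hmem x t)).hasFDerivWithinAt
    have hc : HasDerivAt (fun s : ℝ => (r x, s)) (0, 1) t :=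
      (hasDerivAt_const t (r x)).prodMk (hasDerivAt_id t)
    have key := hd.comp_hasDerivAt t hc (Eventually.of_forall fun s => hmem x s)
    have hsucc : F n (m + 1) = dirDerivWithin S (0, 1) (F n m) := by
      simp only [hFdef, Function.iterate_succ_apply']
    simp only [hsucc]
    exact key

theorem deriv_eq_zero_of_notMem {K : Set ℝ} (hK : IsClosed K) {f : ℝ → ℝ}
    (hf : ∀ x ∉ K, f x = 0) : ∀ x ∉ K, deriv f x = 0 := by
  intro x hx
  have : f =ᶠ[nhds x] fun _ => 0 := by
    filter_upwards [hK.isOpen_compl.mem_nhds hx] with y hy using hf y hy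
  simp [this.deriv_eq]

/-- A smooth function supported near `0` with unit slope at `0`. -/
theorem exists_contDiff_deriv_zero_eq_one : ∃ η : ℝ → ℝ, ContDiff ℝ (⊤ : ℕ∞) η ∧
    (∀ x ∉ Set.Icc (-(1 / 2) : ℝ) (1 / 2), η x = 0) ∧ deriv η 0 = 1 := by
  let b : ContDiffBump (0 : ℝ) := ⟨1 / 4, 1 / 2, by norm_num, by norm_num⟩
  refine ⟨fun x => x * b x, contDiff_id.mul b.contDiff, fun x hx => ?_, ?_⟩
  · have : b x = 0 := b.zero_of_le_dist (by
      rw [Real.dist_eq, sub_zero]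
      by_contra! h
      exact hx (Set.mem_Icc.2 (abs_le.1 h.le)))
    simp [this]
  · have : (fun x => x * b x) =ᶠ[nhds 0] id := by
      filter_upwards [b.eventuallyEq_one] with x hx
      simp [hx]
    simp [this.deriv_eq]

theorem iterate_pd_mul (f g : ℝ → ℝ) (n m : ℕ) :
    pdt^[m] (pdx^[n] fun x t => f x * g t) = fun x t => deriv^[n] f x * deriv^[m] g t := by
  have hx : pdx^[n] (fun x t => f x * g t) = fun x t => deriv^[n] f x * g t := by
    induction n with
    | zero => rfl
    | succ n ih =>
      rw [Function.iterate_succ_apply', ih, Function.iterate_succ_apply']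
      funext x t
      exact deriv_mul_const_field _
  rw [hx]
  induction m with
  | zero => rfl
  | succ m ih =>
    rw [Function.iterate_succ_apply', ih, Function.iterate_succ_apply']
    funext x t
    exact deriv_const_mul_field _

/-- The weak-form integrand on one side of the interface, tested against `ε η(x / ε) φ(t)`, at
`x = ε y` and multiplied by `ε`. -/
def scaledIntegrand (a₁ a₂ a₃ a₄ a₅ a₆ a₇ : ℝ) (Q : ℕ → ℕ → ℝ × ℝ → ℝ) (η φ : ℕ → ℝ → ℝ)
    (ε y t : ℝ) : ℝ :=
  ε ^ 2 * η 0 y * (Q 0 2 (ε * y, t) * φ 2 t - a₅ * Q 0 1 (ε * y, t) * φ 1 t)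
    + ε * η 1 y * (a₁ * Q 1 2 (ε * y, t) * φ 2 t + a₄ * Q 1 1 (ε * y, t) * φ 1 t
      + a₆ * Q 1 0 (ε * y, t) * φ 0 t)
    + η 2 y * (a₂ * Q 2 2 (ε * y, t) * φ 2 t + a₃ * Q 2 1 (ε * y, t) * φ 1 t
      + a₇ * Q 2 0 (ε * y, t) * φ 0 t)

theorem continuous_scaledIntegrand (a₁ a₂ a₃ a₄ a₅ a₆ a₇ : ℝ) {Q : ℕ → ℕ → ℝ × ℝ → ℝ}
    (hQ : ∀ n m, Continuous (Q n m)) {η φ : ℕ → ℝ → ℝ} (hη : ∀ n, Continuous (η n))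
    (hφ : ∀ n, Continuous (φ n)) :
    Continuous fun p : (ℝ × ℝ) × ℝ =>
      scaledIntegrand a₁ a₂ a₃ a₄ a₅ a₆ a₇ Q η φ p.1.1 p.2 p.1.2 := by
  unfold scaledIntegrand
  fun_prop

theorem integral_mul_deriv_of_eq_zero {T : ℝ} {f f' g : ℝ → ℝ} (hf : ∀ t, HasDerivAt f (f' t) t)
    (hf' : Continuous f') (hg : Differentiable ℝ g) (hg' : Continuous (deriv g))
    (hl : g (-T) = 0) (hr : g T = 0) :
    ∫ t in (-T)..T, f t * deriv g t = -∫ t in (-T)..T, f' t * g t := by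
  rw [intervalIntegral.integral_mul_deriv_eq_deriv_mul (fun t _ => hf t)
    (fun t _ => (hg t).hasDerivAt) (hf'.intervalIntegrable _ _) (hg'.intervalIntegrable _ _), hl, hr]
  simp

/-- Moving the time derivatives from the test function to the solution. -/
theorem integral_boundary_term {T a b c : ℝ} {q : ℕ → ℝ → ℝ}
    (hq : ∀ m t, HasDerivAt (q m) (q (m + 1) t) t) {φ : ℝ → ℝ} (hφ : ContDiff ℝ (⊤ : ℕ∞) φ)
    (hl : ∀ n, deriv^[n] φ (-T) = 0) (hr : ∀ n, deriv^[n] φ T = 0) :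
    ∫ t in (-T)..T, (a * q 2 t * deriv^[2] φ t + b * q 1 t * deriv^[1] φ t + c * q 0 t * φ t) =
      ∫ t in (-T)..T, (a * q 4 t - b * q 2 t + c * q 0 t) * φ t := by
  have hqc (m : ℕ) : Continuous (q m) := continuous_iff_continuousAt.2 fun t => (hq m t).continuousAt
  have hφd (n : ℕ) : ContDiff ℝ (⊤ : ℕ∞) (deriv^[n] φ) := hφ.iterate_deriv n
  have hφc (n : ℕ) : Continuous (deriv^[n] φ) := (hφd n).continuous
  have hφc0 : Continuous φ := hφ.continuous
  have parts (m n : ℕ) : ∫ t in (-T)..T, q m t * deriv^[n + 1] φ t =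
      -∫ t in (-T)..T, q (m + 1) t * deriv^[n] φ t := by
    have h := integral_mul_deriv_of_eq_zero (hq m) (hqc _) ((hφd n).differentiable (by simp))
      (by rw [← Function.iterate_succ_apply' deriv]; exact hφc _) (hl n) (hr n)
    simpa only [← Function.iterate_succ_apply' deriv] using h
  have hL : ∫ t in (-T)..T, (a * q 2 t * deriv^[2] φ t + b * q 1 t * deriv^[1] φ t
      + c * q 0 t * φ t) = a * (∫ t in (-T)..T, q 2 t * deriv^[2] φ t)
        + b * (∫ t in (-T)..T, q 1 t * deriv^[1] φ t)
        + c * (∫ t in (-T)..T, q 0 t * deriv^[0] φ t) := by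
    simp only [← intervalIntegral.integral_const_mul]
    rw [← intervalIntegral.integral_add, ← intervalIntegral.integral_add]
    · simp only [Function.iterate_zero, id, mul_assoc]
    all_goals exact Continuous.intervalIntegrable (by fun_prop) _ _
  have hR : ∫ t in (-T)..T, (a * q 4 t - b * q 2 t + c * q 0 t) * φ t
      = a * (∫ t in (-T)..T, q 4 t * deriv^[0] φ t)
        - b * (∫ t in (-T)..T, q 2 t * deriv^[0] φ t)
        + c * (∫ t in (-T)..T, q 0 t * deriv^[0] φ t) := by
    simp only [← intervalIntegral.integral_const_mul]
    rw [← intervalIntegral.integral_sub, ← intervalIntegral.integral_add]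
    · simp only [Function.iterate_zero, id]
      congr 1; funext t; ring
    all_goals exact Continuous.intervalIntegrable (by fun_prop) _ _
  rw [hL, hR, parts 2 1, parts 3 0, parts 1 0]
  ring

theorem integral_eq_scaled_add {g GM GP : ℝ → ℝ} {ε : ℝ} (hε : 0 < ε)
    (hGM : Continuous GM) (hGP : Continuous GP)
    (hM : ∀ y < 0, ε * g (ε * y) = GM y) (hP : ∀ y > 0, ε * g (ε * y) = GP y)
    (hMs : ∀ y ≤ -1, GM y = 0) (hPs : ∀ y > 1, GP y = 0) :
    ∫ x, g x = (∫ y in (-1)..0, GM y) + ∫ y in 0..1, GP y := by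
  have hscale : ∫ x, g x = ∫ y, ε * g (ε * y) := by
    rw [integral_const_mul, Measure.integral_comp_mul_left, abs_of_pos (inv_pos.2 hε), smul_eq_mul,
      mul_inv_cancel_left₀ hε.ne']
  have hsupp : Function.support (fun y => ε * g (ε * y)) ⊆ Set.Ioc (-1) 1 := by
    intro y hy
    by_contra hout
    refine hy ?_
    rw [Set.mem_Ioc, not_and_or, not_lt, not_le] at hout
    rcases hout with h | h
    · exact (hM y (by linarith)).trans (hMs y h)
    · exact (hP y (by linarith)).trans (hPs y h)
  have hMe : Set.EqOn GM (fun y => ε * g (ε * y)) (Set.uIoo (-1) 0) := by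
    intro y hy
    rw [Set.uIoo_of_le (by norm_num)] at hy
    exact (hM y hy.2).symm
  have hPe : Set.EqOn GP (fun y => ε * g (ε * y)) (Set.uIoo 0 1) := by
    intro y hy
    rw [Set.uIoo_of_le (by norm_num)] at hy
    exact (hP y hy.1).symm
  rw [hscale, ← intervalIntegral.integral_eq_integral_of_support_subset hsupp,
    ← intervalIntegral.integral_add_adjacent_intervals
      ((hGM.intervalIntegrable (-1) 0).congr_uIoo hMe)
      ((hGP.intervalIntegrable 0 1).congr_uIoo hPe),
    intervalIntegral.integral_congr_uIoo hMe, intervalIntegral.integral_congr_uIoo hPe]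

/-- The higher-order continuity condition `⟦A₂ ∂ₜ⁴∂ₓ²u − A₃ ∂ₜ²∂ₓ²u + A₇ ∂ₓ²u⟧ = 0` at `x = 0`
for the two-band homogenized model with piecewise constant coefficients. -/
theorem stmt_17 (A1 A2 A3 A4 A5 A6 A7 : ℝ → ℝ)
    (A1m A1p A2m A2p A3m A3p A4m A4p A5m A5p A6m A6p A7m A7p : ℝ)
    (hA1m : ∀ x < (0:ℝ), A1 x = A1m) (hA1p : ∀ x > (0:ℝ), A1 x = A1p)
    (hA2m : ∀ x < (0:ℝ), A2 x = A2m) (hA2p : ∀ x > (0:ℝ), A2 x = A2p)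
    (hA3m : ∀ x < (0:ℝ), A3 x = A3m) (hA3p : ∀ x > (0:ℝ), A3 x = A3p)
    (hA4m : ∀ x < (0:ℝ), A4 x = A4m) (hA4p : ∀ x > (0:ℝ), A4 x = A4p)
    (hA5m : ∀ x < (0:ℝ), A5 x = A5m) (hA5p : ∀ x > (0:ℝ), A5 x = A5p)
    (hA6m : ∀ x < (0:ℝ), A6 x = A6m) (hA6p : ∀ x > (0:ℝ), A6 x = A6p)
    (hA7m : ∀ x < (0:ℝ), A7 x = A7m) (hA7p : ∀ x > (0:ℝ), A7 x = A7p)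
    (u : ℝ → ℝ → ℝ)
    (hcont : Continuous (Function.uncurry u))
    (hcontdx : ∀ t L₁ L₂ : ℝ,
      Tendsto (fun x => pdx u x t) (nhdsWithin 0 (Set.Iio 0)) (nhds L₁) →
      Tendsto (fun x => pdx u x t) (nhdsWithin 0 (Set.Ioi 0)) (nhds L₂) → L₁ = L₂)
    (hsm : ContDiffOn ℝ (⊤ : ℕ∞) (Function.uncurry u) {p : ℝ × ℝ | p.1 ≤ 0})
    (hsp : ContDiffOn ℝ (⊤ : ℕ∞) (Function.uncurry u) {p : ℝ × ℝ | 0 ≤ p.1})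
    (hlim : ∀ (n m : ℕ) (t : ℝ),
      (∃ L : ℝ, Tendsto (fun x => pdx^[n] (pdt^[m] u) x t) (nhdsWithin 0 (Set.Iio 0)) (nhds L)) ∧
      (∃ L : ℝ, Tendsto (fun x => pdx^[n] (pdt^[m] u) x t) (nhdsWithin 0 (Set.Ioi 0)) (nhds L)))
    (hstrong : ∀ x t : ℝ, x ≠ 0 →
      pdt^[4] u x t - A1 x * pdt^[4] (pdx^[2] u) x t + A2 x * pdt^[4] (pdx^[4] u) x t
        - A3 x * pdt^[2] (pdx^[4] u) x t + A4 x * pdt^[2] (pdx^[2] u) x t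
        + A5 x * pdt^[2] u x t - A6 x * pdx^[2] u x t + A7 x * pdx^[4] u x t = 0)
    (hweak : ∀ v : ℝ → ℝ → ℝ, ContDiff ℝ (⊤ : ℕ∞) (Function.uncurry v) →
      HasCompactSupport (Function.uncurry v) →
      (∫ t : ℝ, ∫ x : ℝ,
        (pdt^[2] u x t * pdt^[2] v x t
          + A1 x * pdt^[2] (pdx u) x t * pdt^[2] (pdx v) x t
          + A2 x * pdt^[2] (pdx^[2] u) x t * pdt^[2] (pdx^[2] v) x t
          + A3 x * pdt (pdx^[2] u) x t * pdt (pdx^[2] v) x t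
          + A4 x * pdt (pdx u) x t * pdt (pdx v) x t
          - A5 x * pdt u x t * pdt v x t
          + A6 x * pdx u x t * pdx v x t
          + A7 x * pdx^[2] u x t * pdx^[2] v x t)) = 0) :
    ∀ t L₁ L₂ : ℝ,
      Tendsto (fun x =>
          A2 x * pdt^[4] (pdx^[2] u) x t - A3 x * pdt^[2] (pdx^[2] u) x t
            + A7 x * pdx^[2] u x t)
        (nhdsWithin 0 (Set.Iio 0)) (nhds L₁) →
      Tendsto (fun x =>
          A2 x * pdt^[4] (pdx^[2] u) x t - A3 x * pdt^[2] (pdx^[2] u) x t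
            + A7 x * pdx^[2] u x t)
        (nhdsWithin 0 (Set.Ioi 0)) (nhds L₂) →
      L₂ - L₁ = 0 := by
  have hIm : {p : ℝ × ℝ | p.1 ≤ 0} = Set.Iic 0 ×ˢ Set.univ := by ext; simp
  have hIp : {p : ℝ × ℝ | 0 ≤ p.1} = Set.Ici 0 ×ˢ Set.univ := by ext; simp
  rw [hIm] at hsm
  rw [hIp] at hsp
  obtain ⟨M, hMc, hMu, hMd⟩ := exists_continuous_extension_partials (convex_Iic 0)
    (r := fun x => min x 0) (by rw [interior_Iic]; exact ⟨-1, by simp⟩) (by fun_prop)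
    (fun x => min_le_right x 0) (fun x hx => by rw [interior_Iic] at hx; exact min_eq_left hx.le) hsm
  obtain ⟨P, hPc, hPu, hPd⟩ := exists_continuous_extension_partials (convex_Ici 0)
    (r := fun x => max x 0) (by rw [interior_Ici]; exact ⟨1, by simp⟩) (by fun_prop)
    (fun x => le_max_right x 0) (fun x hx => by rw [interior_Ici] at hx; exact max_eq_left hx.le) hsp
  rw [interior_Iic] at hMu
  rw [interior_Ici] at hPu
  obtain ⟨η, hη, hη0, hη1⟩ := exists_contDiff_deriv_zero_eq_one
  have hηd (n : ℕ) : ContDiff ℝ (⊤ : ℕ∞) (deriv^[n] η) := hη.iterate_deriv n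
  have hηc (n : ℕ) : Continuous (deriv^[n] η) := (hηd n).continuous
  have hηs (n : ℕ) : ∀ x ∉ Set.Icc (-(1 / 2) : ℝ) (1 / 2), deriv^[n] η x = 0 := by
    induction n with
    | zero => exact hη0
    | succ n ih =>
      rw [Function.iterate_succ_apply']
      exact deriv_eq_zero_of_notMem isClosed_Icc ih
  have hη2 (a b : ℝ) : ∫ y in a..b, deriv^[2] η y = deriv η b - deriv η a :=
    intervalIntegral.integral_deriv_eq_sub
      (fun y _ => ((hηd 1).differentiable (by simp)) y) ((hηc 2).intervalIntegrable _ _)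
  have hηl : deriv η (-1) = 0 := hηs 1 (-1) (by norm_num)
  have hηr : deriv η 1 = 0 := hηs 1 1 (by norm_num)
  set JM : ℝ → ℝ := fun t => A2m * M 2 4 (0, t) - A3m * M 2 2 (0, t) + A7m * M 2 0 (0, t) with hJM
  set JP : ℝ → ℝ := fun t => A2p * P 2 4 (0, t) - A3p * P 2 2 (0, t) + A7p * P 2 0 (0, t) with hJP
  have hJMc : Continuous JM := by fun_prop
  have hJPc : Continuous JP := by fun_prop
  have htest : ∀ φ : ℝ → ℝ, ContDiff ℝ (⊤ : ℕ∞) φ → HasCompactSupport φ →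
      ∫ t, φ t • (JM t - JP t) = 0 := by
    intro φ hφ hφs
    obtain ⟨R, hR⟩ := hφs.isCompact.isBounded.subset_closedBall 0
    have hφ0 : ∀ t ∉ Set.Icc (-R) R, φ t = 0 := fun t ht => by
      refine image_eq_zero_of_notMem_tsupport fun h => ht ?_
      simpa [Real.closedBall_eq_Icc] using hR h
    have hφd (n : ℕ) : ContDiff ℝ (⊤ : ℕ∞) (deriv^[n] φ) := hφ.iterate_deriv n
    have hφc (n : ℕ) : Continuous (deriv^[n] φ) := (hφd n).continuous
    have hφn (n : ℕ) : ∀ t ∉ Set.Icc (-R) R, deriv^[n] φ t = 0 := by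
      induction n with
      | zero => exact hφ0
      | succ n ih =>
        rw [Function.iterate_succ_apply']
        exact deriv_eq_zero_of_notMem isClosed_Icc ih
    obtain ⟨T, hTR⟩ : ∃ T, R < T := exists_gt R
    have hφT (t : ℝ) (ht : t ≤ -T ∨ T ≤ t) (n : ℕ) : deriv^[n] φ t = 0 := by
      refine hφn n t fun h => ?_
      rcases ht with h' | h'
      · linarith [h.1]
      · linarith [h.2]
    set GM := scaledIntegrand A1m A2m A3m A4m A5m A6m A7m M (fun n => deriv^[n] η)
      (fun n => deriv^[n] φ) with hGM
    set GP := scaledIntegrand A1p A2p A3p A4p A5p A6p A7p P (fun n => deriv^[n] η)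
      (fun n => deriv^[n] φ) with hGP
    have hGMc : Continuous fun p : (ℝ × ℝ) × ℝ => GM p.1.1 p.2 p.1.2 :=
      continuous_scaledIntegrand _ _ _ _ _ _ _ hMc hηc hφc
    have hGPc : Continuous fun p : (ℝ × ℝ) × ℝ => GP p.1.1 p.2 p.1.2 :=
      continuous_scaledIntegrand _ _ _ _ _ _ _ hPc hηc hφc
    set K : ℝ → ℝ → ℝ := fun ε t =>
      (∫ y in (-1)..0, GM ε y t) + ∫ y in 0..1, GP ε y t with hK
    have hKc : Continuous (Function.uncurry K) :=
      (intervalIntegral.continuous_parametric_intervalIntegral_of_continuous'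
        (f := fun (p : ℝ × ℝ) y => GM p.1 y p.2) hGMc (-1) 0).add
      (intervalIntegral.continuous_parametric_intervalIntegral_of_continuous'
        (f := fun (p : ℝ × ℝ) y => GP p.1 y p.2) hGPc 0 1)
    have hIc : Continuous fun ε => ∫ t in (-T)..T, K ε t :=
      intervalIntegral.continuous_parametric_intervalIntegral_of_continuous' hKc _ _
    have hpos : ∀ ε > 0, ∫ t in (-T)..T, K ε t = 0 := by
      intro ε hε
      set f : ℝ → ℝ := fun x => ε * η (ε⁻¹ * x) with hf
      have hf1 : deriv f = fun x => deriv η (ε⁻¹ * x) := by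
        funext x
        simp only [hf]
        rw [deriv_const_mul_field, deriv_comp_mul_left, smul_eq_mul, mul_inv_cancel_left₀ hε.ne']
      have hfy0 (y : ℝ) : deriv^[0] f (ε * y) = ε * deriv^[0] η y := by
        simp [hf, inv_mul_cancel_left₀ hε.ne']
      have hfy1 (y : ℝ) : deriv^[1] f (ε * y) = deriv^[1] η y := by
        simp [hf1, inv_mul_cancel_left₀ hε.ne']
      have hfy2 (y : ℝ) : deriv^[2] f (ε * y) = ε⁻¹ * deriv^[2] η y := by
        simp [hf1, inv_mul_cancel_left₀ hε.ne', deriv_comp_mul_left]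
      have hf0 : ∀ x ∉ Set.Icc (-ε) ε, f x = 0 := by
        intro x hx
        have : η (ε⁻¹ * x) = 0 := hη0 _ fun h => hx (by
          have h1 : ε * (ε⁻¹ * x) = x := mul_inv_cancel_left₀ hε.ne' x
          constructor <;> nlinarith [h.1, h.2])
        simp [hf, this]
      have hfd : ContDiff ℝ (⊤ : ℕ∞) f :=
        contDiff_const.mul (hη.comp (contDiff_const.mul contDiff_id))
      have hw := hweak (fun x t => f x * φ t)
        ((hfd.comp contDiff_fst).mul (hφ.comp contDiff_snd))
        (HasCompactSupport.intro (K := Set.Icc (-ε) ε ×ˢ Set.Icc (-R) R)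
          (isCompact_Icc.prod isCompact_Icc)
          fun p hp => by
            rw [Set.mem_prod, not_and_or] at hp
            rcases hp with h | h
            · simp [Function.uncurry, hf0 _ h]
            · simp [Function.uncurry, hφ0 _ h])
      set g : ℝ → ℝ → ℝ := fun t x =>
        pdt^[2] (pdx^[0] u) x t * (deriv^[0] f x * deriv^[2] φ t)
          + A1 x * pdt^[2] (pdx^[1] u) x t * (deriv^[1] f x * deriv^[2] φ t)
          + A2 x * pdt^[2] (pdx^[2] u) x t * (deriv^[2] f x * deriv^[2] φ t)
          + A3 x * pdt^[1] (pdx^[2] u) x t * (deriv^[2] f x * deriv^[1] φ t)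
          + A4 x * pdt^[1] (pdx^[1] u) x t * (deriv^[1] f x * deriv^[1] φ t)
          - A5 x * pdt^[1] (pdx^[0] u) x t * (deriv^[0] f x * deriv^[1] φ t)
          + A6 x * pdt^[0] (pdx^[1] u) x t * (deriv^[1] f x * deriv^[0] φ t)
          + A7 x * pdt^[0] (pdx^[2] u) x t * (deriv^[2] f x * deriv^[0] φ t) with hg
      have hpd (n m : ℕ) (x t : ℝ) : deriv^[n] f x * deriv^[m] φ t =
          pdt^[m] (pdx^[n] fun x t => f x * φ t) x t := by rw [iterate_pd_mul]
      have hw' : ∫ t, ∫ x, g t x = 0 := by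
        simp only [hg, hpd]
        exact hw
      have hinner (t : ℝ) := integral_eq_scaled_add (g := g t)
        (GM := fun y => GM ε y t) (GP := fun y => GP ε y t) hε
        (hGMc.comp (by fun_prop : Continuous fun y : ℝ => ((ε, t), y)))
        (hGPc.comp (by fun_prop : Continuous fun y : ℝ => ((ε, t), y)))
        (fun y hy => by
          have hx : ε * y < 0 := mul_neg_of_pos_of_neg hε hy
          have hu (n m : ℕ) := hMu n m (ε * y) t hx
          simp only [hg, hGM, scaledIntegrand, hu, hA1m _ hx, hA2m _ hx, hA3m _ hx, hA4m _ hx,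
            hA5m _ hx, hA6m _ hx, hA7m _ hx, hfy0, hfy1, hfy2]
          field_simp
          ring)
        (fun y hy => by
          have hx : ε * y > 0 := mul_pos hε hy
          have hu (n m : ℕ) := hPu n m (ε * y) t hx
          simp only [hg, hGP, scaledIntegrand, hu, hA1p _ hx, hA2p _ hx, hA3p _ hx, hA4p _ hx,
            hA5p _ hx, hA6p _ hx, hA7p _ hx, hfy0, hfy1, hfy2]
          field_simp
          ring)
        (fun y hy => by
          have h (n : ℕ) : deriv^[n] η y = 0 := hηs n y fun h => by linarith [h.1]
          simp only [hGM, scaledIntegrand, h]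
          ring)
        (fun y hy => by
          have h (n : ℕ) : deriv^[n] η y = 0 := hηs n y fun h => by linarith [h.2]
          simp only [hGP, scaledIntegrand, h]
          ring)
      simp only [hinner] at hw'
      rw [intervalIntegral.integral_eq_integral_of_support_subset]
      · exact hw'
      · intro t ht
        by_contra hout
        refine ht ?_
        rw [Set.mem_Ioc, not_and_or, not_lt, not_le] at hout
        have h := hφT t (hout.imp id le_of_lt)
        simp only [hK, hGM, hGP, scaledIntegrand, h]
        simp
    have hzero : ∫ t in (-T)..T, K 0 t = 0 := by
      have h1 : Tendsto (fun ε => ∫ t in (-T)..T, K ε t) (nhdsWithin 0 (Set.Ioi 0))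
          (nhds (∫ t in (-T)..T, K 0 t)) := (hIc.tendsto 0).mono_left nhdsWithin_le_nhds
      refine tendsto_nhds_unique h1 (tendsto_const_nhds.congr' ?_)
      filter_upwards [self_mem_nhdsWithin] with ε hε using (hpos ε hε).symm
    have hK0 (t : ℝ) : K 0 t =
        (A2m * M 2 2 (0, t) * deriv^[2] φ t + A3m * M 2 1 (0, t) * deriv^[1] φ t
          + A7m * M 2 0 (0, t) * φ t)
        - (A2p * P 2 2 (0, t) * deriv^[2] φ t + A3p * P 2 1 (0, t) * deriv^[1] φ t
          + A7p * P 2 0 (0, t) * φ t) := by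
      simp only [hK, hGM, hGP, scaledIntegrand, zero_mul, ne_eq, OfNat.ofNat_ne_zero,
        not_false_eq_true, zero_pow, zero_add, intervalIntegral.integral_mul_const, hη2, hηl, hηr,
        hη1]
      simp only [Function.iterate_zero, id]
      ring
    have hφ' : Continuous φ := hφ.continuous
    have hbm := integral_boundary_term (T := T) (a := A2m) (b := A3m) (c := A7m)
      (q := fun m t => M 2 m (0, t)) (fun m t => hMd 2 m 0 t) hφ (hφT _ (Or.inl le_rfl))
      (hφT _ (Or.inr le_rfl))
    have hbp := integral_boundary_term (T := T) (a := A2p) (b := A3p) (c := A7p)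
      (q := fun m t => P 2 m (0, t)) (fun m t => hPd 2 m 0 t) hφ (hφT _ (Or.inl le_rfl))
      (hφT _ (Or.inr le_rfl))
    simp only [hK0] at hzero
    rw [intervalIntegral.integral_sub (Continuous.intervalIntegrable (by fun_prop) _ _)
      (Continuous.intervalIntegrable (by fun_prop) _ _), hbm, hbp,
      ← intervalIntegral.integral_sub (Continuous.intervalIntegrable (by fun_prop) _ _)
      (Continuous.intervalIntegrable (by fun_prop) _ _)] at hzero
    rw [← intervalIntegral.integral_eq_integral_of_support_subset (a := -T) (b := T), ← hzero]
    · congr 1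
      funext t
      simp only [hJM, hJP, smul_eq_mul]
      ring
    · intro t ht
      by_contra hout
      refine ht ?_
      rw [Set.mem_Ioc, not_and_or, not_lt, not_le] at hout
      have h : φ t = 0 := hφT t (hout.imp id le_of_lt) 0
      simp [h]
  have hae := ae_eq_zero_of_integral_contDiff_smul_eq_zero
    (μ := volume) (hJMc.sub hJPc).locallyIntegrable htest
  have hJ : (fun t => JM t - JP t) = fun _ => 0 :=
    (Continuous.ae_eq_iff_eq volume (hJMc.sub hJPc) continuous_const).1 hae
  intro t L₁ L₂ h₁ h₂
  have hL₁ : L₁ = JM t := by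
    refine tendsto_nhds_unique h₁ (Tendsto.congr' (f₁ := fun x =>
      A2m * M 2 4 (x, t) - A3m * M 2 2 (x, t) + A7m * M 2 0 (x, t)) ?_ ?_)
    · filter_upwards [self_mem_nhdsWithin] with x hx
      have hu (n m : ℕ) := hMu n m x t hx
      rw [hA2m x hx, hA3m x hx, hA7m x hx, ← hu, ← hu, ← hu]
      rfl
    · exact (Continuous.tendsto (by fun_prop) 0).mono_left nhdsWithin_le_nhds
  have hL₂ : L₂ = JP t := by
    refine tendsto_nhds_unique h₂ (Tendsto.congr' (f₁ := fun x =>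
      A2p * P 2 4 (x, t) - A3p * P 2 2 (x, t) + A7p * P 2 0 (x, t)) ?_ ?_)
    · filter_upwards [self_mem_nhdsWithin] with x hx
      have hu (n m : ℕ) := hPu n m x t hx
      rw [hA2p x hx, hA3p x hx, hA7p x hx, ← hu, ← hu, ← hu]
      rfl
    · exact (Continuous.tendsto (by fun_prop) 0).mono_left nhdsWithin_le_nhds
  have h : JM t - JP t = 0 := congrFun hJ t
  linarith
end
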